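/- arXiv:2008.07732 — 3 statements merged into one kernel-verified Lean document; each statement's English description precedes it below -/
import Mathlib

section
/- Let G be a spray of isotropic curvature R on an open set U ⊆ ℝⁿ (n ≥ 2), i.e., Rⁱ_k = R δⁱ_k − (1/2) R_{·k} yⁱ with R := (1/(n−1)) R^m_m. Then for each l, (n−2)( R_{·l|m} y^m − 2 R_{|l} ) = 0, where R_{|l} := ∂R/∂x^l − N^m_l ∂R/∂y^m and R_{·l|m} y^m := y^m ( ∂(R_{·l})/∂x^m − N^p_m ∂(R_{·l})/∂y^p ) − N^s_l R_{·s}. -/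
open scoped BigOperators

noncomputable section

/-- Points/vectors in local coordinates on an open subset of `ℝⁿ`. -/
abbrev Vec (n : ℕ) := Fin n → ℝ

variable {n : ℕ}

/-- Partial derivative in the base (`x`) variable, in the `k`-th coordinate direction. -/
noncomputable def pdx (f : Vec n → Vec n → ℝ) (k : Fin n) (x y : Vec n) : ℝ :=
  fderiv ℝ (fun x' => f x' y) x (Pi.single k 1)

/-- Partial derivative in the fiber (`y`) variable, in the `k`-th coordinate direction;
this is the operation denoted by a subscript `·k`. -/
noncomputable def pdy (f : Vec n → Vec n → ℝ) (k : Fin n) (x y : Vec n) : ℝ :=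
  fderiv ℝ (fun y' => f x y') y (Pi.single k 1)

/-- Partial derivative of a function of `x` alone. -/
noncomputable def pd (f : Vec n → ℝ) (k : Fin n) (x : Vec n) : ℝ :=
  fderiv ℝ f x (Pi.single k 1)

/-- `G` is a spray on the open set `U ⊆ ℝⁿ`: the coefficients `Gⁱ(x,y)` are smooth for
`x ∈ U`, `y ≠ 0`, and positively homogeneous of degree `2` in `y`. -/
def IsSpray (U : Set (Vec n)) (G : Fin n → Vec n → Vec n → ℝ) : Prop :=
  (∀ i, ContDiffOn ℝ (⊤ : ℕ∞) (fun p : Vec n × Vec n => G i p.1 p.2)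
      (U ×ˢ {y : Vec n | y ≠ 0})) ∧
  (∀ i (x y : Vec n) (lam : ℝ), 0 < lam → G i x (lam • y) = lam ^ 2 * G i x y)

/-- `N^i_j := ∂G^i/∂y^j`. -/
noncomputable def Nc (G : Fin n → Vec n → Vec n → ℝ) (i j : Fin n) (x y : Vec n) : ℝ :=
  pdy (G i) j x y

/-- `Γ^i_{jk} := ∂²G^i/∂y^j∂y^k`. -/
noncomputable def Ga (G : Fin n → Vec n → Vec n → ℝ) (i j k : Fin n) (x y : Vec n) : ℝ :=
  pdy (Nc G i j) k x y

/-- The horizontal derivative `δf/δx^k := ∂f/∂x^k − N^m_k ∂f/∂y^m`; for a scalar `f` this is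
also the horizontal covariant derivative `f_{|k}`. -/
noncomputable def hd (G : Fin n → Vec n → Vec n → ℝ) (f : Vec n → Vec n → ℝ)
    (k : Fin n) (x y : Vec n) : ℝ :=
  pdx f k x y - ∑ m, Nc G m k x y * pdy f m x y

/-- The four-index Riemann curvature tensor
`R_j{}^i{}_{kl} := δΓⁱ_{jl}/δx^k − δΓⁱ_{jk}/δx^l + Γⁱ_{ks}Γ^s_{jl} − Γ^s_{jk}Γⁱ_{ls}`. -/
noncomputable def Riem4 (G : Fin n → Vec n → Vec n → ℝ) (j i k l : Fin n)
    (x y : Vec n) : ℝ :=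
  hd G (Ga G i j l) k x y - hd G (Ga G i j k) l x y
    + ∑ s, (Ga G i k s x y * Ga G s j l x y - Ga G s j k x y * Ga G i l s x y)

/-- The two-index Riemann curvature `R^i_k := y^j R_j{}^i{}_{kl} y^l`. -/
noncomputable def Riem2 (G : Fin n → Vec n → Vec n → ℝ) (i k : Fin n)
    (x y : Vec n) : ℝ :=
  ∑ j, ∑ l, y j * Riem4 G j i k l x y * y l

/-- The χ-curvature `χ_k := −(1/6)(2 R^m_{k·m} + R^m_{m·k})`. -/
noncomputable def chi (G : Fin n → Vec n → Vec n → ℝ) (k : Fin n) (x y : Vec n) : ℝ :=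
  -(1 / 6) * (2 * ∑ m, pdy (Riem2 G m k) m x y + ∑ m, pdy (Riem2 G m m) k x y)

/-- The scalar `R := (1/(n−1)) R^m_m`. -/
noncomputable def Rsc (G : Fin n → Vec n → Vec n → ℝ) (x y : Vec n) : ℝ :=
  (1 / ((n : ℝ) - 1)) * ∑ m, Riem2 G m m x y

/-- `Π := ∂G^m/∂y^m`. -/
noncomputable def PiG (G : Fin n → Vec n → Vec n → ℝ) (x y : Vec n) : ℝ :=
  ∑ m, Nc G m m x y

/-- The S-curvature of `(G, dV)` for the volume form `dV = σ(x) dx¹⋯dxⁿ`: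
`S := Π − y^m ∂(ln σ)/∂x^m`. -/
noncomputable def Scurv (G : Fin n → Vec n → Vec n → ℝ) (σ : Vec n → ℝ)
    (x y : Vec n) : ℝ :=
  PiG G x y - ∑ m, y m * pd (fun x' => Real.log (σ x')) m x

/-- The spray `Ĝ` associated with `(G, dV)`: `Ĝⁱ := Gⁱ − (S/(n+1)) yⁱ`. -/
noncomputable def Ghat (G : Fin n → Vec n → Vec n → ℝ) (σ : Vec n → ℝ)
    (i : Fin n) (x y : Vec n) : ℝ :=
  G i x y - (Scurv G σ x y / ((n : ℝ) + 1)) * y i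

/-- `σ` is the (positive, smooth) density of a volume form `dV = σ(x) dx¹⋯dxⁿ` on `U`. -/
def IsVolumeForm (U : Set (Vec n)) (σ : Vec n → ℝ) : Prop :=
  ContDiffOn ℝ (⊤ : ℕ∞) σ U ∧ ∀ x ∈ U, 0 < σ x

/-- `G` is of isotropic curvature on `U`: `Rⁱ_k = R δⁱ_k − (1/2) R_{·k} yⁱ`. -/
def IsIsotropicCurv (U : Set (Vec n)) (G : Fin n → Vec n → Vec n → ℝ) : Prop :=
  ∀ x ∈ U, ∀ y : Vec n, y ≠ 0 → ∀ i k,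
    Riem2 G i k x y
      = Rsc G x y * (if i = k then 1 else 0) - (1 / 2) * pdy (Rsc G) k x y * y i

/-- `G` is of scalar curvature on `U`: `Rⁱ_k = R δⁱ_k − τ_k yⁱ` for some functions `τ_k`,
positively homogeneous of degree one in `y`, with `τ_k y^k = R`. -/
def IsScalarCurv (U : Set (Vec n)) (G : Fin n → Vec n → Vec n → ℝ) : Prop :=
  ∃ τ : Fin n → Vec n → Vec n → ℝ,
    (∀ k (x y : Vec n) (lam : ℝ), 0 < lam → τ k x (lam • y) = lam * τ k x y) ∧
    ∀ x ∈ U, ∀ y : Vec n, y ≠ 0 →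
      (∑ k, τ k x y * y k) = Rsc G x y ∧
      ∀ i k, Riem2 G i k x y
        = Rsc G x y * (if i = k then 1 else 0) - τ k x y * y i

/-- `F` is smooth at every point of the slit bundle `U × (ℝⁿ \ {0})`. -/
def SmoothSlit (U : Set (Vec n)) (F : Vec n → Vec n → ℝ) : Prop :=
  ∀ x ∈ U, ∀ y : Vec n, y ≠ 0 →
    ContDiffAt ℝ (⊤ : ℕ∞) (fun p : Vec n × Vec n => F p.1 p.2) (x, y)

namespace SmoothSlit

variable {U : Set (Vec n)} {F H : Vec n → Vec n → ℝ}

theorem differentiableAt (hF : SmoothSlit U F) {x y : Vec n} (hx : x ∈ U) (hy : y ≠ 0) :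
    DifferentiableAt ℝ (fun p : Vec n × Vec n => F p.1 p.2) (x, y) :=
  (hF x hx y hy).differentiableAt (by simp)

theorem const (c : ℝ) : SmoothSlit U (fun _ _ => c) :=
  fun _ _ _ _ => contDiffAt_const

theorem coord (j : Fin n) : SmoothSlit U (fun _ y => y j) := by
  intro x _ y _
  fun_prop

theorem add (hF : SmoothSlit U F) (hH : SmoothSlit U H) :
    SmoothSlit U (fun x y => F x y + H x y) :=
  fun x hx y hy => (hF x hx y hy).add (hH x hx y hy)

theorem sub (hF : SmoothSlit U F) (hH : SmoothSlit U H) :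
    SmoothSlit U (fun x y => F x y - H x y) :=
  fun x hx y hy => (hF x hx y hy).sub (hH x hx y hy)

theorem mul (hF : SmoothSlit U F) (hH : SmoothSlit U H) :
    SmoothSlit U (fun x y => F x y * H x y) :=
  fun x hx y hy => (hF x hx y hy).mul (hH x hx y hy)

theorem sum {ι : Type*} [Fintype ι] {F : ι → Vec n → Vec n → ℝ}
    (hF : ∀ i, SmoothSlit U (F i)) : SmoothSlit U (fun x y => ∑ i, F i x y) :=
  fun x hx y hy => ContDiffAt.sum fun i _ => hF i x hx y hy

end SmoothSlit

section Slit

variable {U : Set (Vec n)} {F H : Vec n → Vec n → ℝ}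

theorem eventually_mem_slit (hU : IsOpen U) {x y : Vec n} (hx : x ∈ U) (hy : y ≠ 0) :
    ∀ᶠ p : Vec n × Vec n in nhds (x, y), p.1 ∈ U ∧ p.2 ≠ 0 :=
  ((hU.preimage continuous_fst).inter (isOpen_ne.preimage continuous_snd)).mem_nhds ⟨hx, hy⟩

theorem pdx_eq_fderiv (hF : SmoothSlit U F) {x y : Vec n} (hx : x ∈ U) (hy : y ≠ 0)
    (k : Fin n) :
    pdx F k x y = fderiv ℝ (fun p : Vec n × Vec n => F p.1 p.2) (x, y) (Pi.single k 1, 0) := by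
  have h := (hF.differentiableAt hx hy).hasFDerivAt.comp x
    (hasFDerivAt_prodMk_left (𝕜 := ℝ) x y)
  have hfd : fderiv ℝ (fun x' => F x' y) x = _ := h.fderiv
  simp [pdx, hfd]

theorem pdy_eq_fderiv (hF : SmoothSlit U F) {x y : Vec n} (hx : x ∈ U) (hy : y ≠ 0)
    (k : Fin n) :
    pdy F k x y = fderiv ℝ (fun p : Vec n × Vec n => F p.1 p.2) (x, y) (0, Pi.single k 1) := by
  have h := (hF.differentiableAt hx hy).hasFDerivAt.comp y
    (hasFDerivAt_prodMk_right (𝕜 := ℝ) x y)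
  have hfd : fderiv ℝ (fun y' => F x y') y = _ := h.fderiv
  simp [pdy, hfd]

/-- The operator `D` is differentiation along a vector field on the slit bundle. -/
def IsDerivationSlit (U : Set (Vec n)) (D : (Vec n → Vec n → ℝ) → Vec n → Vec n → ℝ) : Prop :=
  ∃ v : Vec n → Vec n → Vec n × Vec n, ∀ F, SmoothSlit U F → ∀ x ∈ U, ∀ y : Vec n, y ≠ 0 →
    D F x y = fderiv ℝ (fun p : Vec n × Vec n => F p.1 p.2) (x, y) (v x y)

/-- The operator `D` is differentiation along a constant vector field on the slit bundle. -/
def IsPartialSlit (U : Set (Vec n)) (D : (Vec n → Vec n → ℝ) → Vec n → Vec n → ℝ) : Prop :=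
  ∃ v : Vec n × Vec n, ∀ F, SmoothSlit U F → ∀ x ∈ U, ∀ y : Vec n, y ≠ 0 →
    D F x y = fderiv ℝ (fun p : Vec n × Vec n => F p.1 p.2) (x, y) v

theorem isPartialSlit_pdx (k : Fin n) : IsPartialSlit U (fun F => pdx F k) :=
  ⟨_, fun _ hF _ hx _ hy => pdx_eq_fderiv hF hx hy k⟩

theorem isPartialSlit_pdy (k : Fin n) : IsPartialSlit U (fun F => pdy F k) :=
  ⟨_, fun _ hF _ hx _ hy => pdy_eq_fderiv hF hx hy k⟩

namespace IsPartialSlit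

variable {D D' : (Vec n → Vec n → ℝ) → Vec n → Vec n → ℝ}

theorem isDerivationSlit (hD : IsPartialSlit U D) : IsDerivationSlit U D :=
  let ⟨v, hv⟩ := hD
  ⟨fun _ _ => v, hv⟩

theorem smoothSlit (hD : IsPartialSlit U D) (hU : IsOpen U) (hF : SmoothSlit U F) :
    SmoothSlit U (D F) := by
  obtain ⟨v, hv⟩ := hD
  intro x hx y hy
  have h : ContDiffAt ℝ (⊤ : ℕ∞)
      (fun p => fderiv ℝ (fun p : Vec n × Vec n => F p.1 p.2) p v) (x, y) :=
    ((hF x hx y hy).fderiv_right (m := (⊤ : ℕ∞)) (by simp)).clm_apply contDiffAt_const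
  refine h.congr_of_eventuallyEq ?_
  filter_upwards [eventually_mem_slit hU hx hy] with p hp
  exact hv F hF p.1 hp.1 p.2 hp.2

theorem comm (hD : IsPartialSlit U D) (hD' : IsPartialSlit U D') (hU : IsOpen U)
    (hF : SmoothSlit U F) {x y : Vec n} (hx : x ∈ U) (hy : y ≠ 0) :
    D (D' F) x y = D' (D F) x y := by
  have hS := hD.smoothSlit hU hF
  have hS' := hD'.smoothSlit hU hF
  obtain ⟨v, hv⟩ := hD
  obtain ⟨w, hw⟩ := hD'
  set f : Vec n × Vec n → ℝ := fun p => F p.1 p.2 with hf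
  have hd : DifferentiableAt ℝ (fderiv ℝ f) (x, y) :=
    ((hF x hx y hy).fderiv_right (m := (⊤ : ℕ∞)) (by simp)).differentiableAt (by simp)
  have key : ∀ u : Vec n × Vec n, ∀ E : Vec n → Vec n → ℝ,
      (∀ x ∈ U, ∀ y : Vec n, y ≠ 0 → E x y = fderiv ℝ f (x, y) u) →
      ∀ u', fderiv ℝ (fun p : Vec n × Vec n => E p.1 p.2) (x, y) u'
        = fderiv ℝ (fderiv ℝ f) (x, y) u' u := by
    intro u E hE u'
    have h : (fun p : Vec n × Vec n => E p.1 p.2) =ᶠ[nhds (x, y)] fun p => fderiv ℝ f p u := by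
      filter_upwards [eventually_mem_slit hU hx hy] with p hp
      exact hE p.1 hp.1 p.2 hp.2
    rw [h.fderiv_eq, fderiv_clm_apply hd (differentiableAt_const _)]
    simp
  rw [hv _ hS' x hx y hy, hw _ hS x hx y hy, key w _ (hw F hF), key v _ (hv F hF)]
  have h2 : minSmoothness ℝ 2 ≤ (⊤ : ℕ∞) := by
    rw [minSmoothness_of_isRCLikeNormedField]
    exact WithTop.coe_le_coe.mpr (le_top : (2 : ℕ∞) ≤ ⊤)
  exact (hF x hx y hy).isSymmSndFDerivAt h2 v w

end IsPartialSlit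

namespace IsDerivationSlit

variable {D : (Vec n → Vec n → ℝ) → Vec n → Vec n → ℝ} {x y : Vec n}

theorem congr (hD : IsDerivationSlit U D) (hU : IsOpen U) (hF : SmoothSlit U F)
    (hH : SmoothSlit U H) (h : ∀ x ∈ U, ∀ y : Vec n, y ≠ 0 → F x y = H x y)
    (hx : x ∈ U) (hy : y ≠ 0) : D F x y = D H x y := by
  obtain ⟨v, hv⟩ := hD
  rw [hv F hF x hx y hy, hv H hH x hx y hy]
  congr 1
  refine Filter.EventuallyEq.fderiv_eq ?_
  filter_upwards [eventually_mem_slit hU hx hy] with p hp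
  exact h p.1 hp.1 p.2 hp.2

theorem map_const (hD : IsDerivationSlit U D) (c : ℝ) (hx : x ∈ U) (hy : y ≠ 0) :
    D (fun _ _ => c) x y = 0 := by
  obtain ⟨v, hv⟩ := hD
  rw [hv _ (.const c) x hx y hy]
  simp

theorem map_add (hD : IsDerivationSlit U D) (hF : SmoothSlit U F) (hH : SmoothSlit U H)
    (hx : x ∈ U) (hy : y ≠ 0) :
    D (fun x y => F x y + H x y) x y = D F x y + D H x y := by
  obtain ⟨v, hv⟩ := hD
  rw [hv _ (hF.add hH) x hx y hy, hv F hF x hx y hy, hv H hH x hx y hy,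
    fderiv_fun_add (hF.differentiableAt hx hy) (hH.differentiableAt hx hy)]
  rfl

theorem map_sub (hD : IsDerivationSlit U D) (hF : SmoothSlit U F) (hH : SmoothSlit U H)
    (hx : x ∈ U) (hy : y ≠ 0) :
    D (fun x y => F x y - H x y) x y = D F x y - D H x y := by
  obtain ⟨v, hv⟩ := hD
  rw [hv _ (hF.sub hH) x hx y hy, hv F hF x hx y hy, hv H hH x hx y hy,
    fderiv_fun_sub (hF.differentiableAt hx hy) (hH.differentiableAt hx hy)]
  rfl

theorem map_mul (hD : IsDerivationSlit U D) (hF : SmoothSlit U F) (hH : SmoothSlit U H)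
    (hx : x ∈ U) (hy : y ≠ 0) :
    D (fun x y => F x y * H x y) x y = D F x y * H x y + F x y * D H x y := by
  obtain ⟨v, hv⟩ := hD
  rw [hv _ (hF.mul hH) x hx y hy, hv F hF x hx y hy, hv H hH x hx y hy,
    fderiv_fun_mul (hF.differentiableAt hx hy) (hH.differentiableAt hx hy)]
  simp
  ring

theorem map_const_mul (hD : IsDerivationSlit U D) (c : ℝ) (hF : SmoothSlit U F)
    (hx : x ∈ U) (hy : y ≠ 0) :
    D (fun x y => c * F x y) x y = c * D F x y := by
  rw [hD.map_mul (.const c) hF hx hy, hD.map_const c hx hy]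
  ring

theorem map_sum {ι : Type*} [Fintype ι] (hD : IsDerivationSlit U D)
    {F : ι → Vec n → Vec n → ℝ} (hF : ∀ i, SmoothSlit U (F i)) (hx : x ∈ U) (hy : y ≠ 0) :
    D (fun x y => ∑ i, F i x y) x y = ∑ i, D (F i) x y := by
  obtain ⟨v, hv⟩ := hD
  rw [hv _ (.sum hF) x hx y hy,
    fderiv_fun_sum fun i _ => (hF i).differentiableAt hx hy]
  simp [hv _ (hF _) x hx y hy]

end IsDerivationSlit

theorem isDerivationSlit_hd (G : Fin n → Vec n → Vec n → ℝ) (k : Fin n) :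
    IsDerivationSlit U (fun F => hd G F k) := by
  refine ⟨fun x y => (Pi.single k 1, 0) - ∑ m, Nc G m k x y • (0, Pi.single m 1),
    fun F hF x hx y hy => ?_⟩
  simp only [hd, pdx_eq_fderiv hF hx hy, pdy_eq_fderiv hF hx hy, map_sub, map_sum, map_smul,
    smul_eq_mul]

theorem pdx_coord (j k : Fin n) (x y : Vec n) : pdx (fun _ y => y j) k x y = 0 := by
  simp [pdx]

theorem pdy_coord (j k : Fin n) (x y : Vec n) :
    pdy (fun _ y => y j) k x y = if j = k then 1 else 0 := by
  have h : fderiv ℝ (fun y' : Vec n => y' j) y = ContinuousLinearMap.proj j :=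
    (ContinuousLinearMap.proj (R := ℝ) (φ := fun _ : Fin n => ℝ) j).fderiv
  simp [pdy, h, Pi.single_apply]

theorem hd_coord (G : Fin n → Vec n → Vec n → ℝ) (j k : Fin n) (x y : Vec n) :
    hd G (fun _ y => y j) k x y = -Nc G j k x y := by
  simp [hd, pdx_coord, pdy_coord]

theorem SmoothSlit.pdx (hU : IsOpen U) (hF : SmoothSlit U F) (k : Fin n) :
    SmoothSlit U (pdx F k) :=
  (isPartialSlit_pdx k).smoothSlit hU hF

theorem SmoothSlit.pdy (hU : IsOpen U) (hF : SmoothSlit U F) (k : Fin n) :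
    SmoothSlit U (pdy F k) :=
  (isPartialSlit_pdy k).smoothSlit hU hF

end Slit

/-- The curvature `δNⁱ_l/δx^k − δNⁱ_k/δx^l` of the nonlinear connection `N`. -/
def nonlinearCurv (G : Fin n → Vec n → Vec n → ℝ) (i k l : Fin n) (x y : Vec n) : ℝ :=
  hd G (Nc G i l) k x y - hd G (Nc G i k) l x y

namespace IsSpray

variable {U : Set (Vec n)} {G : Fin n → Vec n → Vec n → ℝ} {F : Vec n → Vec n → ℝ} {x y : Vec n}

theorem smoothSlit (hG : IsSpray U G) (hU : IsOpen U) (i : Fin n) : SmoothSlit U (G i) :=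
  fun _ hx _ hy => (hG.1 i).contDiffAt ((hU.prod isOpen_ne).mem_nhds ⟨hx, hy⟩)

theorem smoothSlit_Nc (hG : IsSpray U G) (hU : IsOpen U) (i j : Fin n) :
    SmoothSlit U (Nc G i j) :=
  (hG.smoothSlit hU i).pdy hU j

theorem smoothSlit_Ga (hG : IsSpray U G) (hU : IsOpen U) (i j k : Fin n) :
    SmoothSlit U (Ga G i j k) :=
  (hG.smoothSlit_Nc hU i j).pdy hU k

theorem smoothSlit_hd (hG : IsSpray U G) (hU : IsOpen U) (hF : SmoothSlit U F) (k : Fin n) :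
    SmoothSlit U (hd G F k) :=
  (hF.pdx hU k).sub (.sum fun m => (hG.smoothSlit_Nc hU m k).mul (hF.pdy hU m))

theorem smoothSlit_nonlinearCurv (hG : IsSpray U G) (hU : IsOpen U) (i k l : Fin n) :
    SmoothSlit U (nonlinearCurv G i k l) :=
  (hG.smoothSlit_hd hU (hG.smoothSlit_Nc hU i l) k).sub
    (hG.smoothSlit_hd hU (hG.smoothSlit_Nc hU i k) l)

theorem smoothSlit_Riem4 (hG : IsSpray U G) (hU : IsOpen U) (j i k l : Fin n) :
    SmoothSlit U (Riem4 G j i k l) :=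
  ((hG.smoothSlit_hd hU (hG.smoothSlit_Ga hU i j l) k).sub
    (hG.smoothSlit_hd hU (hG.smoothSlit_Ga hU i j k) l)).add
    (.sum fun s => ((hG.smoothSlit_Ga hU i k s).mul (hG.smoothSlit_Ga hU s j l)).sub
      ((hG.smoothSlit_Ga hU s j k).mul (hG.smoothSlit_Ga hU i l s)))

theorem smoothSlit_Riem2 (hG : IsSpray U G) (hU : IsOpen U) (i k : Fin n) :
    SmoothSlit U (Riem2 G i k) :=
  .sum fun j => .sum fun l => ((SmoothSlit.coord j).mul (hG.smoothSlit_Riem4 hU j i k l)).mul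
    (.coord l)

theorem smoothSlit_Rsc (hG : IsSpray U G) (hU : IsOpen U) : SmoothSlit U (Rsc G) :=
  (SmoothSlit.const _).mul (.sum fun m => hG.smoothSlit_Riem2 hU m m)

theorem Ga_symm (hG : IsSpray U G) (hU : IsOpen U) (hx : x ∈ U) (hy : y ≠ 0) (i j k : Fin n) :
    Ga G i j k x y = Ga G i k j x y :=
  (isPartialSlit_pdy k).comm (isPartialSlit_pdy j) hU (hG.smoothSlit hU i) hx hy

theorem sum_mul_Nc (hG : IsSpray U G) (hU : IsOpen U) (hx : x ∈ U) (hy : y ≠ 0) (i : Fin n) :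
    ∑ l, y l * Nc G i l x y = 2 * G i x y := by
  have hd : DifferentiableAt ℝ (fun y' => G i x y') y :=
    ((hG.smoothSlit hU i).differentiableAt hx hy).comp y
      (hasFDerivAt_prodMk_right x y).differentiableAt
  have h1 : HasDerivAt (fun t : ℝ => G i x (t • y)) (fderiv ℝ (fun y' => G i x y') y y) 1 := by
    have hs : HasDerivAt (fun t : ℝ => t • y) y 1 := by
      simpa using (hasDerivAt_id (1 : ℝ)).smul_const y
    have hd' : HasFDerivAt (fun y' => G i x y') (fderiv ℝ (fun y' => G i x y') y)
        ((1 : ℝ) • y) := by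
      simpa using hd.hasFDerivAt
    exact hd'.comp_hasDerivAt 1 hs
  have h2 : HasDerivAt (fun t : ℝ => G i x (t • y)) (2 * G i x y) 1 := by
    have h : HasDerivAt (fun t : ℝ => t ^ 2 * G i x y) (2 * G i x y) 1 := by
      simpa using (hasDerivAt_pow 2 (1 : ℝ)).mul_const (G i x y)
    refine h.congr_of_eventuallyEq ?_
    filter_upwards [lt_mem_nhds (zero_lt_one' ℝ)] with t ht
    exact hG.2 i x y t ht
  rw [← h1.unique h2]
  have hy_sum : y = ∑ l, y l • (Pi.single l 1 : Vec n) := by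
    ext j
    simp [Finset.sum_apply, Pi.single_apply]
  have h3 := congrArg (fderiv ℝ (fun y' => G i x y') y) hy_sum
  simp only [map_sum, map_smul, smul_eq_mul] at h3
  exact h3.symm

theorem sum_mul_Ga (hG : IsSpray U G) (hU : IsOpen U) (hx : x ∈ U) (hy : y ≠ 0)
    (i l : Fin n) : ∑ j, y j * Ga G i j l x y = Nc G i l x y := by
  have hN := hG.smoothSlit_Nc hU i
  have hD := (isPartialSlit_pdy (U := U) l).isDerivationSlit
  have h := hD.congr hU (.sum fun j => (SmoothSlit.coord j).mul (hN j))
    ((SmoothSlit.const 2).mul (hG.smoothSlit hU i))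
    (fun x hx y hy => hG.sum_mul_Nc hU hx hy i) hx hy
  rw [hD.map_sum (fun j => (SmoothSlit.coord j).mul (hN j)) hx hy,
    hD.map_const_mul _ (hG.smoothSlit hU i) hx hy] at h
  simp only [hD.map_mul (.coord _) (hN _) hx hy, pdy_coord, Finset.sum_add_distrib, ite_mul,
    one_mul, zero_mul, Finset.sum_ite_eq', Finset.mem_univ, if_true] at h
  change Nc G i l x y + ∑ j, y j * Ga G i j l x y = 2 * Nc G i l x y at h
  linarith

theorem sum_mul_Riem4 (hG : IsSpray U G) (hU : IsOpen U) (hx : x ∈ U) (hy : y ≠ 0)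
    (i k l : Fin n) :
    ∑ j, y j * Riem4 G j i k l x y = nonlinearCurv G i k l x y := by
  have hΓ := hG.smoothSlit_Ga hU i
  have h : ∀ k l, ∑ j, y j * hd G (Ga G i j l) k x y
      = hd G (Nc G i l) k x y + ∑ j, Nc G j k x y * Ga G i j l x y := by
    intro k l
    have hD := isDerivationSlit_hd (U := U) G k
    have h := hD.congr hU (.sum fun j => (SmoothSlit.coord j).mul (hΓ j l))
      (hG.smoothSlit_Nc hU i l) (fun x hx y hy => hG.sum_mul_Ga hU hx hy i l) hx hy
    rw [hD.map_sum (fun j => (SmoothSlit.coord j).mul (hΓ j l)) hx hy] at h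
    simp only [hD.map_mul (.coord _) (hΓ _ l) hx hy, hd_coord, Finset.sum_add_distrib, neg_mul,
      Finset.sum_neg_distrib] at h
    linarith
  have h' : ∑ j, y j * ∑ s, (Ga G i k s x y * Ga G s j l x y - Ga G s j k x y * Ga G i l s x y)
      = ∑ s, Nc G s l x y * Ga G i s k x y - ∑ s, Nc G s k x y * Ga G i s l x y := by
    simp only [Finset.mul_sum]
    rw [Finset.sum_comm, ← Finset.sum_sub_distrib]
    refine Finset.sum_congr rfl fun s _ => ?_
    rw [← hG.sum_mul_Ga hU hx hy s l, ← hG.sum_mul_Ga hU hx hy s k, hG.Ga_symm hU hx hy i s k,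
      hG.Ga_symm hU hx hy i s l, Finset.sum_mul, Finset.sum_mul, ← Finset.sum_sub_distrib]
    exact Finset.sum_congr rfl fun j _ => by ring
  simp only [Riem4, mul_add, mul_sub, Finset.sum_add_distrib, Finset.sum_sub_distrib] at h' ⊢
  rw [h, h, h', nonlinearCurv]
  ring

theorem Riem2_eq_sum (hG : IsSpray U G) (hU : IsOpen U) (hx : x ∈ U) (hy : y ≠ 0)
    (i k : Fin n) : Riem2 G i k x y = ∑ l, y l * nonlinearCurv G i k l x y := by
  rw [Riem2, Finset.sum_comm]
  refine Finset.sum_congr rfl fun l _ => ?_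
  rw [← hG.sum_mul_Riem4 hU hx hy, ← Finset.sum_mul, mul_comm]

theorem Riem2_eq (hG : IsSpray U G) (hU : IsOpen U) (hx : x ∈ U) (hy : y ≠ 0)
    (i k : Fin n) :
    Riem2 G i k x y = 2 * pdx (G i) k x y - ∑ m, y m * pdx (Nc G i k) m x y
      + 2 * ∑ m, G m x y * Ga G i k m x y - ∑ m, Nc G m k x y * Nc G i m x y := by
  have hN := hG.smoothSlit_Nc hU i
  have hD := (isPartialSlit_pdx (U := U) k).isDerivationSlit
  have h1 := hD.congr hU (.sum fun j => (SmoothSlit.coord j).mul (hN j))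
    ((SmoothSlit.const 2).mul (hG.smoothSlit hU i))
    (fun x hx y hy => hG.sum_mul_Nc hU hx hy i) hx hy
  rw [hD.map_sum (fun j => (SmoothSlit.coord j).mul (hN j)) hx hy,
    hD.map_const_mul _ (hG.smoothSlit hU i) hx hy] at h1
  simp only [hD.map_mul (.coord _) (hN _) hx hy, pdx_coord, zero_mul, zero_add] at h1
  have h2 : ∑ l, y l * ∑ m, Nc G m k x y * Ga G i l m x y
      = ∑ m, Nc G m k x y * Nc G i m x y := by
    simp only [Finset.mul_sum]
    rw [Finset.sum_comm]
    refine Finset.sum_congr rfl fun m _ => ?_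
    rw [← hG.sum_mul_Ga hU hx hy i m, Finset.mul_sum]
    exact Finset.sum_congr rfl fun l _ => by ring
  have h3 : ∑ l, y l * ∑ m, Nc G m l x y * Ga G i k m x y
      = 2 * ∑ m, G m x y * Ga G i k m x y := by
    simp only [Finset.mul_sum]
    rw [Finset.sum_comm]
    refine Finset.sum_congr rfl fun m _ => ?_
    rw [← mul_assoc, ← hG.sum_mul_Nc hU hx hy m, Finset.sum_mul]
    exact Finset.sum_congr rfl fun l _ => by ring
  rw [hG.Riem2_eq_sum hU hx hy]
  simp only [nonlinearCurv, hd, mul_sub, Finset.sum_sub_distrib]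
  change _ - ∑ l, y l * ∑ m, Nc G m k x y * Ga G i l m x y
    - (_ - ∑ l, y l * ∑ m, Nc G m l x y * Ga G i k m x y) = _
  rw [h1, h2, h3]
  ring

theorem pdy_Ga_swap (hG : IsSpray U G) (hU : IsOpen U) (hx : x ∈ U) (hy : y ≠ 0)
    (i k l m : Fin n) : pdy (Ga G i k m) l x y = pdy (Ga G i l m) k x y := by
  rw [(isPartialSlit_pdy l).isDerivationSlit.congr hU (hG.smoothSlit_Ga hU i k m)
      (hG.smoothSlit_Ga hU i m k) (fun x hx y hy => hG.Ga_symm hU hx hy i k m) hx hy,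
    (isPartialSlit_pdy k).isDerivationSlit.congr hU (hG.smoothSlit_Ga hU i l m)
      (hG.smoothSlit_Ga hU i m l) (fun x hx y hy => hG.Ga_symm hU hx hy i l m) hx hy]
  exact (isPartialSlit_pdy l).comm (isPartialSlit_pdy k) hU (hG.smoothSlit_Nc hU i m) hx hy

theorem pdy_Riem2 (hG : IsSpray U G) (hU : IsOpen U) (hx : x ∈ U) (hy : y ≠ 0)
    (i k l : Fin n) :
    pdy (Riem2 G i k) l x y = 2 * pdx (Nc G i l) k x y - pdx (Nc G i k) l x y
      - ∑ m, y m * pdx (Ga G i k l) m x y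
      + 2 * ∑ m, (Nc G m l x y * Ga G i k m x y + G m x y * pdy (Ga G i k m) l x y)
      - ∑ m, (Ga G m k l x y * Nc G i m x y + Nc G m k x y * Ga G i m l x y) := by
  have hD := (isPartialSlit_pdy (U := U) l).isDerivationSlit
  have sG := hG.smoothSlit hU
  have sN := hG.smoothSlit_Nc hU
  have sΓ := hG.smoothSlit_Ga hU
  have hcomm : ∀ F, SmoothSlit U F → ∀ m, pdy (pdx F m) l x y = pdx (pdy F l) m x y :=
    fun F hF m => (isPartialSlit_pdy l).comm (isPartialSlit_pdx m) hU hF hx hy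
  have s1 : ∀ m, SmoothSlit U (fun x y => y m * pdx (Nc G i k) m x y) :=
    fun m => (SmoothSlit.coord m).mul ((sN i k).pdx hU m)
  have s2 : ∀ m, SmoothSlit U (fun x y => G m x y * Ga G i k m x y) :=
    fun m => (sG m).mul (sΓ i k m)
  have s3 : ∀ m, SmoothSlit U (fun x y => Nc G m k x y * Nc G i m x y) :=
    fun m => (sN m k).mul (sN i m)
  have s0 := (SmoothSlit.const 2).mul ((sG i).pdx hU k)
  have s4 := (SmoothSlit.const 2).mul (SmoothSlit.sum s2)
  rw [hD.congr hU (hG.smoothSlit_Riem2 hU i k)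
      (((s0.sub (.sum s1)).add s4).sub (.sum s3))
      (fun x hx y hy => hG.Riem2_eq hU hx hy i k) hx hy,
    hD.map_sub ((s0.sub (.sum s1)).add s4) (.sum s3) hx hy,
    hD.map_add (s0.sub (.sum s1)) s4 hx hy, hD.map_sub s0 (.sum s1) hx hy,
    hD.map_const_mul _ ((sG i).pdx hU k) hx hy, hD.map_const_mul _ (.sum s2) hx hy,
    hD.map_sum s1 hx hy, hD.map_sum s2 hx hy, hD.map_sum s3 hx hy]
  simp only [fun m => hD.map_mul (.coord m) ((sN i k).pdx hU m) hx hy,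
    fun m => hD.map_mul (sG m) (sΓ i k m) hx hy,
    fun m => hD.map_mul (sN m k) (sN i m) hx hy, pdy_coord, hcomm _ (sG i),
    hcomm _ (sN i k), Finset.sum_add_distrib, ite_mul, one_mul, zero_mul, Finset.sum_ite_eq',
    Finset.mem_univ, if_true]
  have hN : ∀ m, pdy (G m) l = Nc G m l := fun _ => rfl
  have hΓ : ∀ i k l, pdy (Nc G i k) l = Ga G i k l := fun _ _ _ => rfl
  simp only [hN, hΓ]
  ring

theorem pdy_Riem2_sub (hG : IsSpray U G) (hU : IsOpen U) (hx : x ∈ U) (hy : y ≠ 0)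
    (i k l : Fin n) :
    pdy (Riem2 G i k) l x y - pdy (Riem2 G i l) k x y = 3 * nonlinearCurv G i k l x y := by
  have hΓ : ∀ m, pdx (Ga G i k l) m x y = pdx (Ga G i l k) m x y := fun m =>
    (isPartialSlit_pdx m).isDerivationSlit.congr hU (hG.smoothSlit_Ga hU i k l)
      (hG.smoothSlit_Ga hU i l k) (fun x hx y hy => hG.Ga_symm hU hx hy i k l) hx hy
  simp only [hG.pdy_Riem2 hU hx hy, hG.pdy_Ga_swap hU hx hy i l k, hΓ,
    hG.Ga_symm hU hx hy _ l k, hG.Ga_symm hU hx hy i _ l, hG.Ga_symm hU hx hy i _ k,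
    nonlinearCurv, hd, Finset.sum_add_distrib]
  change _ = 3 * ((_ - ∑ m, Nc G m k x y * Ga G i l m x y)
    - (_ - ∑ m, Nc G m l x y * Ga G i k m x y))
  ring

theorem hd_comm (hG : IsSpray U G) (hU : IsOpen U) (hF : SmoothSlit U F) (hx : x ∈ U)
    (hy : y ≠ 0) (k l : Fin n) :
    hd G (hd G F l) k x y - hd G (hd G F k) l x y
      = -∑ m, nonlinearCurv G m k l x y * pdy F m x y := by
  have sN := hG.smoothSlit_Nc hU
  have expand : ∀ k l, hd G (hd G F l) k x y
      = pdx (pdx F l) k x y - ∑ m, Nc G m k x y * pdx (pdy F m) l x y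
        - ∑ m, (hd G (Nc G m l) k x y * pdy F m x y
          + Nc G m l x y * (pdx (pdy F m) k x y - ∑ p, Nc G p k x y * pdy (pdy F m) p x y)) := by
    intro k l
    have hD := isDerivationSlit_hd (U := U) G k
    have s : ∀ m, SmoothSlit U (fun x y => Nc G m l x y * pdy F m x y) :=
      fun m => (sN m l).mul (hF.pdy hU m)
    change hd G (fun x y => pdx F l x y - ∑ m, Nc G m l x y * pdy F m x y) k x y = _
    rw [hD.map_sub (hF.pdx hU l) (.sum s) hx hy, hD.map_sum s hx hy]
    simp only [fun m => hD.map_mul (sN m l) (hF.pdy hU m) hx hy]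
    congr 1
    simp only [hd, fun m => (isPartialSlit_pdy m).comm (isPartialSlit_pdx l) hU hF hx hy]
  have hsymm : ∑ m, Nc G m l x y * ∑ p, Nc G p k x y * pdy (pdy F m) p x y
      = ∑ m, Nc G m k x y * ∑ p, Nc G p l x y * pdy (pdy F m) p x y := by
    simp only [Finset.mul_sum]
    rw [Finset.sum_comm]
    refine Finset.sum_congr rfl fun m _ => Finset.sum_congr rfl fun p _ => ?_
    rw [(isPartialSlit_pdy m).comm (isPartialSlit_pdy p) hU hF hx hy]
    ring
  rw [expand, expand, (isPartialSlit_pdx k).comm (isPartialSlit_pdx l) hU hF hx hy]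
  simp only [nonlinearCurv, Finset.sum_add_distrib, mul_sub, sub_mul, Finset.sum_sub_distrib]
  linarith

/-- The second Bianchi identity. -/
theorem bianchi (hG : IsSpray U G) (hU : IsOpen U) (hx : x ∈ U) (hy : y ≠ 0)
    (i k l m : Fin n) :
    hd G (nonlinearCurv G i k l) m x y + hd G (nonlinearCurv G i l m) k x y
      + hd G (nonlinearCurv G i m k) l x y
      = -∑ s, (nonlinearCurv G s k l x y * Ga G i m s x y
        + nonlinearCurv G s l m x y * Ga G i k s x y
        + nonlinearCurv G s m k x y * Ga G i l s x y) := by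
  have sN := hG.smoothSlit_Nc hU i
  have expand : ∀ k l m, hd G (nonlinearCurv G i k l) m x y
      = hd G (hd G (Nc G i l) k) m x y - hd G (hd G (Nc G i k) l) m x y := fun k l m =>
    (isDerivationSlit_hd G m).map_sub (hG.smoothSlit_hd hU (sN l) k)
      (hG.smoothSlit_hd hU (sN k) l) hx hy
  have h1 := hG.hd_comm hU (sN l) hx hy m k
  have h2 := hG.hd_comm hU (sN m) hx hy k l
  have h3 := hG.hd_comm hU (sN k) hx hy l m
  change _ = -∑ s, nonlinearCurv G s m k x y * Ga G i l s x y at h1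
  change _ = -∑ s, nonlinearCurv G s k l x y * Ga G i m s x y at h2
  change _ = -∑ s, nonlinearCurv G s l m x y * Ga G i k s x y at h3
  simp only [expand, Finset.sum_add_distrib]
  linarith

end IsSpray

namespace IsIsotropicCurv

variable {U : Set (Vec n)} {G : Fin n → Vec n → Vec n → ℝ} {x y : Vec n}

theorem nonlinearCurv_eq (hiso : IsIsotropicCurv U G) (hG : IsSpray U G) (hU : IsOpen U)
    (hx : x ∈ U) (hy : y ≠ 0) (i k l : Fin n) :
    nonlinearCurv G i k l x y
      = (1 / 2) * (pdy (Rsc G) l x y * (if i = k then 1 else 0)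
        - pdy (Rsc G) k x y * (if i = l then 1 else 0)) := by
  have sR := hG.smoothSlit_Rsc hU
  have h : ∀ k l, pdy (Riem2 G i k) l x y
      = pdy (Rsc G) l x y * (if i = k then 1 else 0)
        - (1 / 2 * pdy (pdy (Rsc G) k) l x y * y i
          + 1 / 2 * pdy (Rsc G) k x y * (if i = l then 1 else 0)) := by
    intro k l
    have hD := (isPartialSlit_pdy (U := U) l).isDerivationSlit
    have sk := (SmoothSlit.const (1 / 2)).mul (sR.pdy hU k)
    rw [hD.congr hU (hG.smoothSlit_Riem2 hU i k)
        ((sR.mul (.const _)).sub (sk.mul (.coord i)))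
        (fun x hx y hy => hiso x hx y hy i k) hx hy,
      hD.map_sub (sR.mul (.const _)) (sk.mul (.coord i)) hx hy,
      hD.map_mul sR (.const _) hx hy, hD.map_mul sk (.coord i) hx hy,
      hD.map_const_mul _ (sR.pdy hU k) hx hy, hD.map_const _ hx hy, pdy_coord]
    ring
  have h3 := hG.pdy_Riem2_sub hU hx hy i k l
  rw [h, h, (isPartialSlit_pdy l).comm (isPartialSlit_pdy k) hU sR hx hy] at h3
  linarith

theorem sum_mul_pdy_Rsc (hiso : IsIsotropicCurv U G) (hG : IsSpray U G) (hU : IsOpen U)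
    (hx : x ∈ U) (hy : y ≠ 0) : ∑ m, y m * pdy (Rsc G) m x y = 2 * Rsc G x y := by
  obtain ⟨i, hi⟩ := Function.ne_iff.mp hy
  have h := hiso x hx y hy i
  have h0 : ∑ k, Riem2 G i k x y * y k = 0 := by
    have hs : ∑ k, Riem2 G i k x y * y k
        = ∑ k, ∑ l, y k * y l * nonlinearCurv G i k l x y := by
      refine Finset.sum_congr rfl fun k _ => ?_
      rw [hG.Riem2_eq_sum hU hx hy, Finset.sum_mul]
      exact Finset.sum_congr rfl fun l _ => by ring
    have hneg : ∑ k, ∑ l, y k * y l * nonlinearCurv G i k l x y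
        = -∑ k, ∑ l, y k * y l * nonlinearCurv G i k l x y := by
      conv_lhs => rw [Finset.sum_comm]
      simp only [← Finset.sum_neg_distrib]
      refine Finset.sum_congr rfl fun k _ => Finset.sum_congr rfl fun l _ => ?_
      simp only [nonlinearCurv]
      ring
    linarith
  have h1 : ∑ k, Riem2 G i k x y * y k
      = y i * (Rsc G x y - 1 / 2 * ∑ m, y m * pdy (Rsc G) m x y) := by
    simp only [h, sub_mul, Finset.sum_sub_distrib, mul_ite, ite_mul, mul_one, mul_zero, zero_mul,
      Finset.sum_ite_eq, Finset.mem_univ, if_true]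
    rw [mul_sub, Finset.mul_sum, Finset.mul_sum, mul_comm]
    congr 1
    exact Finset.sum_congr rfl fun k _ => by ring
  have h2 := (mul_eq_zero.mp (h1.symm.trans h0)).resolve_left hi
  linarith

theorem hd_pdy_Rsc_symm (hiso : IsIsotropicCurv U G) (hG : IsSpray U G) (hU : IsOpen U)
    (hx : x ∈ U) (hy : y ≠ 0) (l m : Fin n) :
    ((n : ℝ) - 2) * (hd G (pdy (Rsc G) l) m x y - hd G (pdy (Rsc G) m) l x y) = 0 := by
  have sR := fun k => (hG.smoothSlit_Rsc hU).pdy hU k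
  have hK : ∀ i k l m, hd G (nonlinearCurv G i k l) m x y
      = (1 / 2) * (hd G (pdy (Rsc G) l) m x y * (if i = k then 1 else 0)
        - hd G (pdy (Rsc G) k) m x y * (if i = l then 1 else 0)) := by
    intro i k l m
    have hD := isDerivationSlit_hd (U := U) G m
    have sl := (sR l).mul (.const (if i = k then 1 else 0))
    have sk := (sR k).mul (.const (if i = l then 1 else 0))
    rw [hD.congr hU (hG.smoothSlit_nonlinearCurv hU i k l)
        ((SmoothSlit.const (1 / 2)).mul (sl.sub sk))
        (fun x hx y hy => hiso.nonlinearCurv_eq hG hU hx hy i k l) hx hy,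
      hD.map_const_mul _ (sl.sub sk) hx hy, hD.map_sub sl sk hx hy,
      hD.map_mul (sR l) (.const _) hx hy, hD.map_mul (sR k) (.const _) hx hy,
      hD.map_const _ hx hy, hD.map_const _ hx hy]
    ring
  have hb : ∀ i k, hd G (nonlinearCurv G i k l) m x y + hd G (nonlinearCurv G i l m) k x y
      + hd G (nonlinearCurv G i m k) l x y = 0 := by
    intro i k
    rw [hG.bianchi hU hx hy]
    simp only [hiso.nonlinearCurv_eq hG hU hx hy, Finset.sum_add_distrib, mul_sub, sub_mul,
      Finset.sum_sub_distrib, mul_ite, ite_mul, mul_one, mul_zero, zero_mul, Finset.sum_ite_eq',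
      Finset.mem_univ, if_true]
    rw [hG.Ga_symm hU hx hy i m k, hG.Ga_symm hU hx hy i m l, hG.Ga_symm hU hx hy i l k]
    ring
  have ht := Finset.sum_eq_zero fun i (_ : i ∈ Finset.univ) => hb i i
  simp only [hK, if_true, Finset.sum_add_distrib, ← Finset.mul_sum, Finset.sum_sub_distrib,
    mul_ite, mul_one, mul_zero, Finset.sum_ite_eq', Finset.mem_univ, Finset.sum_const,
    Finset.card_univ, Fintype.card_fin, nsmul_eq_mul] at ht
  linarith

end IsIsotropicCurv

/-- for a spray of isotropic curvature,
`(n−2)(R_{·l|m} y^m − 2 R_{|l}) = 0`. -/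
theorem isotropic_curvature_identity
    {n : ℕ} (hn : 2 ≤ n) (U : Set (Vec n)) (hU : IsOpen U)
    (G : Fin n → Vec n → Vec n → ℝ) (hG : IsSpray U G)
    (hiso : IsIsotropicCurv U G) :
    ∀ x ∈ U, ∀ y : Vec n, y ≠ 0 → ∀ l,
      ((n : ℝ) - 2) *
        ((∑ m, y m * hd G (fun x' y' => pdy (Rsc G) l x' y') m x y
            - ∑ s, Nc G s l x y * pdy (Rsc G) s x y)
          - 2 * hd G (Rsc G) l x y) = 0 := by
  intro x hx y hy l
  have sR := hG.smoothSlit_Rsc hU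
  have hD := isDerivationSlit_hd (U := U) G l
  have s : ∀ m, SmoothSlit U (fun x y => y m * pdy (Rsc G) m x y) :=
    fun m => (SmoothSlit.coord m).mul (sR.pdy hU m)
  have h := hD.congr hU (.sum s) ((SmoothSlit.const 2).mul sR)
    (fun x hx y hy => hiso.sum_mul_pdy_Rsc hG hU hx hy) hx hy
  rw [hD.map_sum s hx hy, hD.map_const_mul _ sR hx hy] at h
  simp only [fun m => hD.map_mul (.coord m) (sR.pdy hU m) hx hy, hd_coord,
    Finset.sum_add_distrib, neg_mul, Finset.sum_neg_distrib] at h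
  have hsum : ∑ m, y m * (((n : ℝ) - 2)
      * (hd G (pdy (Rsc G) l) m x y - hd G (pdy (Rsc G) m) l x y)) = 0 :=
    Finset.sum_eq_zero fun m _ => by rw [hiso.hd_pdy_Rsc_symm hG hU hx hy, mul_zero]
  rw [← h, ← hsum]
  have hpull : ∀ m, y m * (((n : ℝ) - 2)
      * (hd G (pdy (Rsc G) l) m x y - hd G (pdy (Rsc G) m) l x y))
      = ((n : ℝ) - 2) * (y m * hd G (pdy (Rsc G) l) m x y
        - y m * hd G (pdy (Rsc G) m) l x y) := fun m => by ring
  simp only [hpull, ← Finset.mul_sum, Finset.sum_sub_distrib]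
  ring
end
end

section
/- Let G be a spray of isotropic curvature R on an open set U ⊆ ℝⁿ with n ≥ 3, i.e., Rⁱ_k = R δⁱ_k − (1/2) R_{·k} yⁱ with R := (1/(n−1)) R^m_m. Then R satisfies (1/2) R_{·l|m} y^m − R_{|l} = 0 for each l, where R_{|l} := ∂R/∂x^l − N^m_l ∂R/∂y^m and R_{·l|m} y^m := y^m ( ∂(R_{·l})/∂x^m − N^p_m ∂(R_{·l})/∂y^p ) − N^s_l R_{·s}. -/
open scoped BigOperators

noncomputable section

variable {n : ℕ}

section SprayAlgebra

variable {A : Type*} [CommRing A] [Algebra ℝ A]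

/-- The horizontal derivation `δ_k = X_k - ∑ m, N^m_k Y_m`, with `N^m_k = Y_k G^m`. -/
def horDer (X Y : Fin n → Derivation ℝ A A) (G : Fin n → A) (k : Fin n) : Derivation ℝ A A :=
  X k - ∑ m, Y k (G m) • Y m

/-- The curvature `R^i_{kl} = δ_k N^i_l - δ_l N^i_k` of the nonlinear connection. -/
def connCurv (X Y : Fin n → Derivation ℝ A A) (G : Fin n → A) (i k l : Fin n) : A :=
  horDer X Y G k (Y l (G i)) - horDer X Y G l (Y k (G i))

variable {X Y : Fin n → Derivation ℝ A A} {G y : Fin n → A}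

lemma horDer_apply (k : Fin n) (a : A) :
    horDer X Y G k a = X k a - ∑ m, Y k (G m) * Y m a := by
  have h := congrFun (map_sum Derivation.coeFnAddMonoidHom (fun m => Y k (G m) • Y m)
    Finset.univ) a
  rw [Finset.sum_apply] at h
  rw [horDer, Derivation.sub_apply]
  exact congrArg (X k a - ·) h

lemma horDer_comm (hXX : ∀ j k a, X j (X k a) = X k (X j a))
    (hXY : ∀ j k a, X j (Y k a) = Y k (X j a)) (hYY : ∀ j k a, Y j (Y k a) = Y k (Y j a))
    (k l : Fin n) (a : A) :
    horDer X Y G k (horDer X Y G l a) - horDer X Y G l (horDer X Y G k a)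
      = -∑ i, connCurv X Y G i k l * Y i a := by
  have key : ∀ k l, horDer X Y G k (horDer X Y G l a)
      = X k (X l a) - ∑ m, Y k (G m) * X l (Y m a) - ∑ m, Y l (G m) * X k (Y m a)
        + ∑ m, ∑ s, Y l (G m) * (Y k (G s) * Y m (Y s a))
        - ∑ m, horDer X Y G k (Y l (G m)) * Y m a := by
    intro k l
    rw [horDer_apply l, map_sub, map_sum]
    simp only [Derivation.leibniz, smul_eq_mul, Finset.sum_add_distrib]
    simp only [horDer_apply k (X l a), horDer_apply k (Y _ a), mul_sub, Finset.sum_sub_distrib,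
      Finset.mul_sum, hXY l]
    simp only [hYY _ _ a, mul_comm (Y _ a)]
    ring
  have hsymm : ∑ m, ∑ s, Y l (G m) * (Y k (G s) * Y m (Y s a))
      = ∑ m, ∑ s, Y k (G m) * (Y l (G s) * Y m (Y s a)) := by
    rw [Finset.sum_comm]
    refine Finset.sum_congr rfl fun m _ => Finset.sum_congr rfl fun s _ => ?_
    rw [hYY s m]; ring
  rw [key k l, key l k, hsymm, hXX k l]
  simp only [connCurv, sub_mul, Finset.sum_sub_distrib]
  ring

lemma vert_horDer (hXY : ∀ j k a, X j (Y k a) = Y k (X j a))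
    (hYY : ∀ j k a, Y j (Y k a) = Y k (Y j a)) (j k : Fin n) (a : A) :
    Y j (horDer X Y G k a) = horDer X Y G k (Y j a) - ∑ m, Y j (Y k (G m)) * Y m a := by
  simp only [horDer_apply, map_sub, map_sum, Derivation.leibniz, smul_eq_mul,
    Finset.sum_add_distrib, hXY, hYY _ j a, mul_comm (Y _ a)]
  ring

lemma vert_connCurv (hXY : ∀ j k a, X j (Y k a) = Y k (X j a))
    (hYY : ∀ j k a, Y j (Y k a) = Y k (Y j a)) (j i k l : Fin n) :
    Y j (connCurv X Y G i k l)
      = horDer X Y G k (Y j (Y l (G i))) - horDer X Y G l (Y j (Y k (G i)))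
        + ∑ s, (Y s (Y k (G i)) * Y l (Y j (G s)) - Y k (Y j (G s)) * Y s (Y l (G i))) := by
  simp only [connCurv, map_sub, vert_horDer hXY hYY, Finset.sum_sub_distrib, hYY j k, hYY j l,
    mul_comm (Y l (Y j (G _)))]
  ring

lemma sum_mul_vert_vert (hYy : ∀ j k, Y j (y k) = if j = k then 1 else 0)
    (hYY : ∀ j k a, Y j (Y k a) = Y k (Y j a))
    (hG : ∀ i, ∑ k, y k * Y k (G i) = 2 * G i) (i k : Fin n) :
    ∑ m, y m * Y m (Y k (G i)) = Y k (G i) := by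
  have h := congrArg (Y k) (hG i)
  have h2 : Y k (2 : A) = 0 := by
    simpa using (Y k).map_natCast 2
  simp only [map_sum, Derivation.leibniz, smul_eq_mul, Finset.sum_add_distrib, hYy, h2] at h
  simp only [hYY k, mul_ite, mul_one, mul_zero, Finset.sum_ite_eq, Finset.mem_univ, if_true] at h
  linear_combination h

lemma horDer_coord (hXy : ∀ j k, X j (y k) = 0)
    (hYy : ∀ j k, Y j (y k) = if j = k then 1 else 0) (k m : Fin n) :
    horDer X Y G k (y m) = -Y k (G m) := by
  simp [horDer_apply, hXy, hYy]

lemma sum_mul_horDer (hXy : ∀ j k, X j (y k) = 0)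
    (hYy : ∀ j k, Y j (y k) = if j = k then 1 else 0) (k : Fin n) (a : Fin n → A) :
    ∑ m, y m * horDer X Y G k (a m)
      = horDer X Y G k (∑ m, y m * a m) + ∑ m, Y k (G m) * a m := by
  simp only [map_sum, Derivation.leibniz, smul_eq_mul, Finset.sum_add_distrib,
    horDer_coord hXy hYy, mul_comm (a _)]
  simp

lemma sum_mul_vert_connCurv (hXY : ∀ j k a, X j (Y k a) = Y k (X j a))
    (hYY : ∀ j k a, Y j (Y k a) = Y k (Y j a)) (hXy : ∀ j k, X j (y k) = 0)
    (hYy : ∀ j k, Y j (y k) = if j = k then 1 else 0)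
    (hG : ∀ i, ∑ k, y k * Y k (G i) = 2 * G i) (i k l : Fin n) :
    ∑ j, y j * Y j (connCurv X Y G i k l) = connCurv X Y G i k l := by
  have hN := sum_mul_vert_vert hYy hYY hG
  have hquad : ∀ k l, ∑ j, y j * ∑ s, Y s (Y k (G i)) * Y l (Y j (G s))
      = ∑ s, Y s (Y k (G i)) * Y l (G s) := by
    intro k l
    simp only [Finset.mul_sum]
    rw [Finset.sum_comm]
    refine Finset.sum_congr rfl fun s _ => ?_
    rw [← hN s l, Finset.mul_sum]
    refine Finset.sum_congr rfl fun j _ => ?_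
    rw [hYY l j]; ring
  have h1 := hquad k l
  have h2 := hquad l k
  simp only [vert_connCurv hXY hYY, mul_add, mul_sub, Finset.sum_add_distrib,
    Finset.sum_sub_distrib, sum_mul_horDer hXy hYy, hN]
  simp only [mul_comm (Y k (Y _ (G _)))]
  rw [h1, h2]
  simp only [mul_comm (Y _ (Y _ (G i))), connCurv]
  ring

lemma vert_connCurv_cyclic (hXY : ∀ j k a, X j (Y k a) = Y k (X j a))
    (hYY : ∀ j k a, Y j (Y k a) = Y k (Y j a)) (i k l m : Fin n) :
    Y l (connCurv X Y G i k m) - Y k (connCurv X Y G i l m) = Y m (connCurv X Y G i k l) := by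
  simp only [vert_connCurv hXY hYY, Finset.sum_sub_distrib, hYY l m, hYY k m, hYY l k,
    mul_comm (Y _ (Y _ (G i)))]
  ring

lemma three_mul_connCurv (hXY : ∀ j k a, X j (Y k a) = Y k (X j a))
    (hYY : ∀ j k a, Y j (Y k a) = Y k (Y j a)) (hXy : ∀ j k, X j (y k) = 0)
    (hYy : ∀ j k, Y j (y k) = if j = k then 1 else 0)
    (hG : ∀ i, ∑ k, y k * Y k (G i) = 2 * G i) (i k l : Fin n) :
    3 * connCurv X Y G i k l = Y l (∑ m, y m * connCurv X Y G i k m)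
      - Y k (∑ m, y m * connCurv X Y G i l m) := by
  have h : ∑ m, y m * (Y l (connCurv X Y G i k m) - Y k (connCurv X Y G i l m))
      = connCurv X Y G i k l := by
    simp only [vert_connCurv_cyclic hXY hYY]
    exact sum_mul_vert_connCurv hXY hYY hXy hYy hG i k l
  have hanti : connCurv X Y G i l k = -connCurv X Y G i k l := by
    simp [connCurv]
  simp only [mul_sub, Finset.sum_sub_distrib] at h
  simp only [map_sum, Derivation.leibniz, smul_eq_mul, Finset.sum_add_distrib, hYy, mul_ite,
    mul_one, mul_zero, Finset.sum_ite_eq, Finset.mem_univ, if_true]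
  linear_combination -h + hanti

lemma horDer_connCurv_cyclic (hXX : ∀ j k a, X j (X k a) = X k (X j a))
    (hXY : ∀ j k a, X j (Y k a) = Y k (X j a)) (hYY : ∀ j k a, Y j (Y k a) = Y k (Y j a))
    (i k l m : Fin n) :
    horDer X Y G m (connCurv X Y G i k l) + horDer X Y G k (connCurv X Y G i l m)
        + horDer X Y G l (connCurv X Y G i m k)
      = -(∑ s, connCurv X Y G s m k * Y s (Y l (G i))
        + ∑ s, connCurv X Y G s k l * Y s (Y m (G i))
        + ∑ s, connCurv X Y G s l m * Y s (Y k (G i))) := by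
  have h := fun k l => horDer_comm (G := G) hXX hXY hYY k l
  have h1 := h m k (Y l (G i))
  have h2 := h k l (Y m (G i))
  have h3 := h l m (Y k (G i))
  simp only [connCurv, map_sub] at h1 h2 h3 ⊢
  linear_combination h1 + h2 + h3

lemma real_algebra_mul_left_cancel {c : ℕ} (hc : c ≠ 0) {a b : A} (h : (c : A) * a = c * b) :
    a = b := by
  have hc' : (c : ℝ) ≠ 0 := by exact_mod_cast hc
  have h' : (c : ℝ) • a = (c : ℝ) • b := by simpa [Algebra.smul_def] using h
  simpa [smul_smul, hc'] using congrArg (fun z => (c : ℝ)⁻¹ • z) h'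

/-- For isotropic curvature in dimension at least three, `δ_m R_{·l}` is symmetric. -/
lemma horDer_vert_symm (hn : 3 ≤ n) (hXX : ∀ j k a, X j (X k a) = X k (X j a))
    (hXY : ∀ j k a, X j (Y k a) = Y k (X j a)) (hYY : ∀ j k a, Y j (Y k a) = Y k (Y j a))
    (hXy : ∀ j k, X j (y k) = 0) (hYy : ∀ j k, Y j (y k) = if j = k then 1 else 0)
    (hG : ∀ i, ∑ k, y k * Y k (G i) = 2 * G i) {R : A}
    (hR : ∀ i k, 2 * ∑ m, y m * connCurv X Y G i k m
      = 2 * (R * if i = k then 1 else 0) - Y k R * y i) (l m : Fin n) :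
    horDer X Y G m (Y l R) = horDer X Y G l (Y m R) := by
  have two_vert : ∀ k : Fin n, Y k (2 : A) = 0 := fun k => by simpa using (Y k).map_natCast 2
  have two_hor : ∀ k : Fin n, horDer X Y G k (2 : A) = 0 := fun k => by
    simpa using (horDer X Y G k).map_natCast 2
  have hcurv : ∀ i k l, 2 * connCurv X Y G i k l
      = Y l R * (if k = i then 1 else 0) - Y k R * (if l = i then 1 else 0) := by
    intro i k l
    refine real_algebra_mul_left_cancel three_ne_zero ?_
    have h3 := three_mul_connCurv hXY hYY hXy hYy hG i k l
    have e1 := congrArg (Y l) (hR i k)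
    have e2 := congrArg (Y k) (hR i l)
    have hite : ∀ p q : Fin n, Y p (if i = q then (1 : A) else 0) = 0 := by
      intro p q; split_ifs <;> simp
    rw [map_sub, Derivation.leibniz, Derivation.leibniz, Derivation.leibniz,
      Derivation.leibniz] at e1 e2
    simp only [smul_eq_mul, two_vert, hite, hYy] at e1 e2
    rw [hYY k l] at e2
    simp only [eq_comm (a := i)] at e1 e2
    push_cast
    linear_combination 2 * h3 + e1 - e2
  rcases eq_or_ne l m with rfl | hlm
  · rfl
  obtain ⟨i, hi⟩ : ∃ i : Fin n, i ∉ ({l, m} : Finset (Fin n)) := by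
    by_contra! h
    have h1 := Finset.card_le_card (fun i _ => h i : (Finset.univ : Finset (Fin n)) ⊆ {l, m})
    have h2 := Finset.card_le_two (a := l) (b := m)
    simp only [Finset.card_univ, Fintype.card_fin] at h1
    omega
  simp only [Finset.mem_insert, Finset.mem_singleton, not_or] at hi
  have hcyc := congrArg (fun z => 2 * z) (horDer_connCurv_cyclic (G := G) hXX hXY hYY i i l m)
  have hpull : ∀ k (a : A), 2 * horDer X Y G k a = horDer X Y G k (2 * a) := by
    intro k a; simp [Derivation.leibniz, two_hor]
  simp only [mul_add, mul_neg, hpull, Finset.mul_sum, ← mul_assoc, hcurv, sub_mul,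
    Finset.sum_sub_distrib] at hcyc
  simp [Ne.symm hi.1, Ne.symm hi.2] at hcyc
  rw [hYY i l, hYY i m, hYY m l] at hcyc
  linear_combination hcyc

/-- The algebraic form of the identity `½ R_{·l|m} y^m = R_{|l}`. -/
lemma isotropic_identity (hn : 3 ≤ n) (hXX : ∀ j k a, X j (X k a) = X k (X j a))
    (hXY : ∀ j k a, X j (Y k a) = Y k (X j a)) (hYY : ∀ j k a, Y j (Y k a) = Y k (Y j a))
    (hXy : ∀ j k, X j (y k) = 0) (hYy : ∀ j k, Y j (y k) = if j = k then 1 else 0)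
    (hG : ∀ i, ∑ k, y k * Y k (G i) = 2 * G i) {R : A}
    (htr : ((n : A) - 1) * R = ∑ i, ∑ m, y m * connCurv X Y G i i m)
    (hR : ∀ i k, 2 * ∑ m, y m * connCurv X Y G i k m
      = 2 * (R * if i = k then 1 else 0) - Y k R * y i) (l : Fin n) :
    ∑ m, y m * horDer X Y G m (Y l R) - ∑ s, Y l (G s) * Y s R
      = 2 * horDer X Y G l R := by
  have heuler : ∑ m, y m * Y m R = 2 * R := by
    have h : ∑ i, 2 * ∑ m, y m * connCurv X Y G i i m = ∑ i, (2 * R - y i * Y i R) :=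
      Finset.sum_congr rfl fun i _ => by rw [hR i i, if_pos rfl]; ring
    rw [← Finset.mul_sum, ← htr, Finset.sum_sub_distrib, Finset.sum_const, Finset.card_univ,
      Fintype.card_fin, nsmul_eq_mul] at h
    linear_combination h
  have hsymm := horDer_vert_symm hn hXX hXY hYY hXy hYy hG hR
  have two_hor : horDer X Y G l (2 : A) = 0 := by simpa using (horDer X Y G l).map_natCast 2
  simp only [hsymm l, sum_mul_horDer hXy hYy, heuler, Derivation.leibniz, smul_eq_mul, two_hor]
  ring

end SprayAlgebra

section SmoothFunctions

variable {E : Type*} [NormedAddCommGroup E] [NormedSpace ℝ E] {W : Set E}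

/-- The algebra of real functions on `W` that are restrictions of functions smooth on `W`. -/
def smoothFun (W : Set E) : Subalgebra ℝ (W → ℝ) where
  carrier := {a | ∃ F : E → ℝ, ContDiffOn ℝ (⊤ : ℕ∞) F W ∧ ∀ p : W, a p = F p}
  mul_mem' := by
    rintro a b ⟨F, hF, ha⟩ ⟨F', hF', hb⟩
    exact ⟨_, hF.mul hF', fun p => by simp [ha, hb]⟩
  add_mem' := by
    rintro a b ⟨F, hF, ha⟩ ⟨F', hF', hb⟩
    exact ⟨_, hF.add hF', fun p => by simp [ha, hb]⟩
  algebraMap_mem' := fun r => ⟨fun _ => r, contDiffOn_const, fun _ => rfl⟩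

/-- The restriction to `W` of a function smooth on `W`, as an element of `smoothFun W`. -/
def smoothRestrict (F : E → ℝ) (hF : ContDiffOn ℝ (⊤ : ℕ∞) F W) : smoothFun W :=
  ⟨fun p => F p, F, hF, fun _ => rfl⟩

/-- A function on the whole space, smooth on `W`, whose restriction is `a`. -/
def smoothExt (a : smoothFun W) : E → ℝ := a.2.choose

lemma smoothExt_contDiffOn (a : smoothFun W) : ContDiffOn ℝ (⊤ : ℕ∞) (smoothExt a) W :=
  a.2.choose_spec.1

lemma smoothExt_apply (a : smoothFun W) (p : W) : smoothExt a p = a.1 p :=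
  (a.2.choose_spec.2 p).symm

lemma fderiv_smoothExt (hW : IsOpen W) (a : smoothFun W) {F : E → ℝ}
    (hF : ∀ p : W, F p = a.1 p) (p : W) : fderiv ℝ (smoothExt a) p = fderiv ℝ F p := by
  refine Filter.EventuallyEq.fderiv_eq ?_
  filter_upwards [hW.mem_nhds p.2] with q hq
  rw [smoothExt_apply a ⟨q, hq⟩, hF ⟨q, hq⟩]

lemma smoothExt_differentiableAt (hW : IsOpen W) (a : smoothFun W) (p : W) :
    DifferentiableAt ℝ (smoothExt a) p :=
  ((smoothExt_contDiffOn a).contDiffAt (hW.mem_nhds p.2)).differentiableAt (by simp)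

/-- The directional derivative in the direction `v`, as a derivation of `smoothFun W`. -/
def dirDeriv (hW : IsOpen W) (v : E) : Derivation ℝ (smoothFun W) (smoothFun W) :=
  Derivation.mk'
    { toFun := fun a => smoothRestrict (fun p => fderiv ℝ (smoothExt a) p v)
        (((smoothExt_contDiffOn a).fderiv_of_isOpen hW (by simp)).clm_apply contDiffOn_const)
      map_add' := fun a b => by
        ext p
        have h := fderiv_smoothExt hW (a + b) (F := smoothExt a + smoothExt b)
          (fun p => by simp [smoothExt_apply]) p
        simp only [smoothRestrict, h]
        rw [fderiv_add (smoothExt_differentiableAt hW a p) (smoothExt_differentiableAt hW b p)]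
        rfl
      map_smul' := fun r a => by
        ext p
        have h := fderiv_smoothExt hW (r • a) (F := r • smoothExt a)
          (fun p => by simp [smoothExt_apply]) p
        simp only [smoothRestrict, h]
        rw [fderiv_const_smul (smoothExt_differentiableAt hW a p)]
        rfl }
    fun a b => by
      ext p
      have h := fderiv_smoothExt hW (a * b) (F := smoothExt a * smoothExt b)
        (fun p => by simp [smoothExt_apply]) p
      simp only [smoothRestrict, LinearMap.coe_mk, AddHom.coe_mk, h]
      rw [fderiv_mul (smoothExt_differentiableAt hW a p) (smoothExt_differentiableAt hW b p)]
      simp [smoothExt_apply]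

lemma dirDeriv_apply (hW : IsOpen W) (v : E) (a : smoothFun W) {F : E → ℝ}
    (hF : ∀ p : W, F p = a.1 p) (p : W) : (dirDeriv hW v a).1 p = fderiv ℝ F p v := by
  rw [← fderiv_smoothExt hW a hF p]
  rfl

lemma dirDeriv_comm (hW : IsOpen W) (v w : E) (a : smoothFun W) :
    dirDeriv hW v (dirDeriv hW w a) = dirDeriv hW w (dirDeriv hW v a) := by
  ext p
  have hd : DifferentiableAt ℝ (fderiv ℝ (smoothExt a)) p :=
    (((smoothExt_contDiffOn a).fderiv_of_isOpen hW (m := (⊤ : ℕ∞)) (by simp)).contDiffAt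
      (hW.mem_nhds p.2)).differentiableAt (by simp)
  have key : ∀ v w : E, (dirDeriv hW v (dirDeriv hW w a)).1 p
      = fderiv ℝ (fderiv ℝ (smoothExt a)) p v w := by
    intro v w
    rw [dirDeriv_apply hW v _ (F := fun q => fderiv ℝ (smoothExt a) q w) (fun _ => rfl),
      fderiv_clm_apply hd (differentiableAt_const w)]
    simp
  rw [key, key]
  exact ((smoothExt_contDiffOn a).contDiffAt (hW.mem_nhds p.2)).isSymmSndFDerivAt
    (by simpa using WithTop.coe_le_coe.2 (le_top : (2 : ℕ∞) ≤ ⊤)) v w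

end SmoothFunctions

section Slit

variable {U : Set (Vec n)}

/-- The slit tangent bundle of `U`. -/
def slit (U : Set (Vec n)) : Set (Vec n × Vec n) := U ×ˢ {y : Vec n | y ≠ 0}

lemma isOpen_slit (hU : IsOpen U) : IsOpen (slit U) := hU.prod isOpen_ne

/-- The coordinate derivation `∂/∂x^k` on smooth functions on the slit tangent bundle. -/
def baseDer (hU : IsOpen U) (k : Fin n) : Derivation ℝ (smoothFun (slit U)) (smoothFun (slit U)) :=
  dirDeriv (isOpen_slit hU) (Pi.single k 1, 0)

/-- The coordinate derivation `∂/∂y^k` on smooth functions on the slit tangent bundle. -/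
def fiberDer (hU : IsOpen U) (k : Fin n) :
    Derivation ℝ (smoothFun (slit U)) (smoothFun (slit U)) :=
  dirDeriv (isOpen_slit hU) (0, Pi.single k 1)

/-- The fiber coordinate `y^k`. -/
def fiberCoord (U : Set (Vec n)) (k : Fin n) : smoothFun (slit U) :=
  smoothRestrict (fun p => p.2 k) (by fun_prop)

/-- `f` and `a` agree on the slit tangent bundle. -/
def Represents (f : Vec n → Vec n → ℝ) (a : smoothFun (slit U)) : Prop :=
  ∀ p : slit U, f p.1.1 p.1.2 = a.1 p

variable {f : Vec n → Vec n → ℝ} {a : smoothFun (slit U)} {G : Fin n → Vec n → Vec n → ℝ}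
  {g : Fin n → smoothFun (slit U)}

lemma Represents.hasFDerivAt (hU : IsOpen U) (h : Represents f a) (p : slit U) :
    HasFDerivAt (fun q : Vec n × Vec n => f q.1 q.2)
      (fderiv ℝ (fun q : Vec n × Vec n => f q.1 q.2) p) p := by
  refine DifferentiableAt.hasFDerivAt ?_
  refine (smoothExt_differentiableAt (isOpen_slit hU) a p).congr_of_eventuallyEq ?_
  filter_upwards [(isOpen_slit hU).mem_nhds p.2] with q hq
  rw [smoothExt_apply a ⟨q, hq⟩, ← h ⟨q, hq⟩]

lemma Represents.pdx (hU : IsOpen U) (h : Represents f a) (k : Fin n) :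
    Represents (pdx f k) (baseDer hU k a) := by
  intro p
  have h1 := (h.hasFDerivAt hU p).comp p.1.1 (f := fun x' => (x', p.1.2))
    (hasFDerivAt_prodMk_left p.1.1 p.1.2)
  rw [baseDer, dirDeriv_apply _ _ a (F := fun q => f q.1 q.2) h p]
  refine (congrArg (fun L => L (Pi.single k 1)) h1.fderiv).trans ?_
  simp

lemma Represents.pdy (hU : IsOpen U) (h : Represents f a) (k : Fin n) :
    Represents (pdy f k) (fiberDer hU k a) := by
  intro p
  have h1 := (h.hasFDerivAt hU p).comp p.1.2 (f := fun y' => (p.1.1, y'))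
    (hasFDerivAt_prodMk_right p.1.1 p.1.2)
  rw [fiberDer, dirDeriv_apply _ _ a (F := fun q => f q.1 q.2) h p]
  refine (congrArg (fun L => L (Pi.single k 1)) h1.fderiv).trans ?_
  simp

lemma coe_smoothFun_sum {ι : Type*} (s : Finset ι) (b : ι → smoothFun (slit U)) (p : slit U) :
    (∑ i ∈ s, b i).1 p = ∑ i ∈ s, (b i).1 p := by
  have h : (∑ i ∈ s, b i).1 = ∑ i ∈ s, (b i).1 := AddSubmonoidClass.coe_finsetSum b s
  rw [h, Finset.sum_apply]

lemma coe_smoothFun_sum_mul_sub {ι : Type*} [Fintype ι] {b c d e : ι → smoothFun (slit U)}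
    {z : smoothFun (slit U)} (h : ∑ i, b i * c i - ∑ i, d i * e i = 2 * z) (p : slit U) :
    ∑ i, (b i).1 p * (c i).1 p - ∑ i, (d i).1 p * (e i).1 p = 2 * z.1 p := by
  have hbc := coe_smoothFun_sum Finset.univ (fun i => b i * c i) p
  have hde := coe_smoothFun_sum Finset.univ (fun i => d i * e i) p
  exact (congrArg₂ (· - ·) hbc hde).symm.trans (congrArg (fun a => a.1 p) h)

lemma Represents.hd (hU : IsOpen U) (hG : ∀ i, Represents (G i) (g i)) (h : Represents f a)
    (k : Fin n) :
    Represents (hd G f k) (horDer (baseDer hU) (fiberDer hU) g k a) := by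
  intro p
  have hN : ∀ m, Nc G m k p.1.1 p.1.2 = (fiberDer hU k (g m)).1 p := fun m => (hG m).pdy hU k p
  simp only [_root_.hd, hN, h.pdx hU k p, h.pdy hU _ p, horDer_apply]
  refine Eq.trans ?_ (congrArg (fun z => (baseDer hU k a).1 p - z)
    (coe_smoothFun_sum _ _ p).symm)
  rfl

lemma baseDer_comm (hU : IsOpen U) (j k : Fin n) (a : smoothFun (slit U)) :
    baseDer hU j (baseDer hU k a) = baseDer hU k (baseDer hU j a) :=
  dirDeriv_comm _ _ _ a

lemma baseDer_fiberDer_comm (hU : IsOpen U) (j k : Fin n) (a : smoothFun (slit U)) :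
    baseDer hU j (fiberDer hU k a) = fiberDer hU k (baseDer hU j a) :=
  dirDeriv_comm _ _ _ a

lemma fiberDer_comm (hU : IsOpen U) (j k : Fin n) (a : smoothFun (slit U)) :
    fiberDer hU j (fiberDer hU k a) = fiberDer hU k (fiberDer hU j a) :=
  dirDeriv_comm _ _ _ a

lemma fderiv_fiberCoord (k : Fin n) (p v : Vec n × Vec n) :
    fderiv ℝ (fun q : Vec n × Vec n => q.2 k) p v = v.2 k :=
  congrArg (fun L => L v) ((ContinuousLinearMap.proj (R := ℝ) k).comp
    (ContinuousLinearMap.snd ℝ (Vec n) (Vec n))).hasFDerivAt.fderiv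

lemma baseDer_fiberCoord (hU : IsOpen U) (j k : Fin n) :
    baseDer hU j (fiberCoord U k) = 0 := by
  ext p
  rw [baseDer, dirDeriv_apply _ _ _ (F := fun q => q.2 k) (fun _ => rfl), fderiv_fiberCoord]
  rfl

lemma fiberDer_fiberCoord (hU : IsOpen U) (j k : Fin n) :
    fiberDer hU j (fiberCoord U k) = if j = k then 1 else 0 := by
  ext p
  rw [fiberDer, dirDeriv_apply _ _ _ (F := fun q => q.2 k) (fun _ => rfl), fderiv_fiberCoord]
  by_cases h : j = k
  · subst h; simp
  · simp [h, Ne.symm h]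

lemma euler_of_homogeneous (hU : IsOpen U) (hG : ∀ i, Represents (G i) (g i))
    (hhom : ∀ i (x y : Vec n) (lam : ℝ), 0 < lam → G i x (lam • y) = lam ^ 2 * G i x y)
    (i : Fin n) : ∑ k, fiberCoord U k * fiberDer hU k (g i) = 2 * g i := by
  ext p
  rw [coe_smoothFun_sum]
  have h1 := (hG i).hasFDerivAt hU p
  have hline : HasDerivAt (fun t : ℝ => (p.1.1, t • p.1.2)) (0, p.1.2) 1 :=
    (hasDerivAt_const (1 : ℝ) p.1.1).prodMk
      (by simpa using (hasDerivAt_id (1 : ℝ)).smul_const p.1.2)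
  have h2 : HasDerivAt (fun t : ℝ => G i p.1.1 (t • p.1.2))
      (fderiv ℝ (fun q : Vec n × Vec n => G i q.1 q.2) p (0, p.1.2)) 1 :=
    HasFDerivAt.comp_hasDerivAt (1 : ℝ) (f := fun t : ℝ => (p.1.1, t • p.1.2))
      (l := fun q : Vec n × Vec n => G i q.1 q.2) (by simpa using h1) hline
  have h3 : HasDerivAt (fun t : ℝ => G i p.1.1 (t • p.1.2)) (2 * G i p.1.1 p.1.2) 1 := by
    have h4 : HasDerivAt (fun t : ℝ => t ^ 2 * G i p.1.1 p.1.2) (2 * G i p.1.1 p.1.2) 1 := by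
      simpa using (hasDerivAt_pow 2 (1 : ℝ)).mul_const (G i p.1.1 p.1.2)
    refine h4.congr_of_eventuallyEq ?_
    filter_upwards [lt_mem_nhds (zero_lt_one' ℝ)] with t ht using hhom i _ _ t ht
  have hvec : ((0, p.1.2) : Vec n × Vec n)
      = ∑ k, p.1.2 k • ((0, Pi.single k 1) : Vec n × Vec n) := by
    ext j
    · simp [Prod.fst_sum]
    · simp [Prod.snd_sum, Finset.sum_apply, Pi.single_apply]
  have h5 := h2.unique h3
  rw [hvec, map_sum] at h5
  refine Eq.trans (Finset.sum_congr rfl fun k _ => ?_) (h5.trans (by rw [hG i p]; rfl))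
  rw [map_smul, ← dirDeriv_apply (isOpen_slit hU) _ (g i) (F := fun q => G i q.1 q.2) (hG i) p]
  rfl

lemma Represents.riem2 (hU : IsOpen U) (hG : ∀ i, Represents (G i) (g i))
    (heuler : ∀ i, ∑ k, fiberCoord U k * fiberDer hU k (g i) = 2 * g i) (i k : Fin n) :
    Represents (Riem2 G i k)
      (∑ m, fiberCoord U m * connCurv (baseDer hU) (fiberDer hU) g i k m) := by
  intro p
  have h4 : ∀ j l, Riem4 G j i k l p.1.1 p.1.2
      = (fiberDer hU j (connCurv (baseDer hU) (fiberDer hU) g i k l)).1 p := by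
    intro j l
    have hΓ : ∀ i j k, Represents (Ga G i j k) (fiberDer hU k (fiberDer hU j (g i))) :=
      fun i j k => ((hG i).pdy hU j).pdy hU k
    rw [vert_connCurv (baseDer_fiberDer_comm hU) (fiberDer_comm hU), Riem4,
      (hΓ i j l).hd hU hG k p, (hΓ i j k).hd hU hG l p]
    simp only [hΓ _ _ _ p, fiberDer_comm hU l j, fiberDer_comm hU k j]
    refine congrArg₂ (· + ·) rfl ?_
    rw [coe_smoothFun_sum]
    rfl
  have hL : ∀ l, ∑ j, p.1.2 j * Riem4 G j i k l p.1.1 p.1.2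
      = (connCurv (baseDer hU) (fiberDer hU) g i k l).1 p := by
    intro l
    have h := congrArg (fun a : smoothFun (slit U) => a.1 p)
      (sum_mul_vert_connCurv (baseDer_fiberDer_comm hU) (fiberDer_comm hU)
        (baseDer_fiberCoord hU) (fiberDer_fiberCoord hU) heuler i k l)
    simp only [coe_smoothFun_sum] at h
    rw [← h]
    exact Finset.sum_congr rfl fun j _ => by rw [h4]; rfl
  rw [coe_smoothFun_sum, Riem2, Finset.sum_comm]
  refine Finset.sum_congr rfl fun l _ => ?_
  rw [← Finset.sum_mul, hL, mul_comm]
  rfl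

lemma Represents.rsc (hU : IsOpen U) (hG : ∀ i, Represents (G i) (g i))
    (heuler : ∀ i, ∑ k, fiberCoord U k * fiberDer hU k (g i) = 2 * g i) (hn : n ≠ 1) :
    ∃ R : smoothFun (slit U), Represents (Rsc G) R ∧ ((n : smoothFun (slit U)) - 1) * R
      = ∑ i, ∑ m, fiberCoord U m * connCurv (baseDer hU) (fiberDer hU) g i i m := by
  refine ⟨(1 / ((n : ℝ) - 1)) •
    ∑ i, ∑ m, fiberCoord U m * connCurv (baseDer hU) (fiberDer hU) g i i m, fun p => ?_, ?_⟩
  · rw [Rsc, Finset.sum_congr rfl fun i _ => Represents.riem2 hU hG heuler i i p,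
      ← coe_smoothFun_sum]
    rfl
  · have hn1 : (n : ℝ) - 1 ≠ 0 := sub_ne_zero.2 (by exact_mod_cast hn)
    have hcast : (n : smoothFun (slit U)) - 1
        = algebraMap ℝ (smoothFun (slit U)) ((n : ℝ) - 1) := by simp
    rw [hcast, ← Algebra.smul_def, smul_smul, mul_one_div_cancel hn1, one_smul]

lemma Represents.isotropic (hU : IsOpen U) {R : smoothFun (slit U)}
    {C : Fin n → Fin n → smoothFun (slit U)} (hR : Represents (Rsc G) R)
    (hC : ∀ i k, Represents (Riem2 G i k) (C i k)) (hiso : IsIsotropicCurv U G) (i k : Fin n) :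
    2 * C i k = 2 * (R * if i = k then 1 else 0) - fiberDer hU k R * fiberCoord U i := by
  ext p
  have h := hiso p.1.1 p.2.1 p.1.2 p.2.2 i k
  rw [hC i k p, hR p, hR.pdy hU k p] at h
  have hite : (if i = k then (1 : ℝ) else 0)
      = (if i = k then (1 : smoothFun (slit U)) else 0).1 p := by split_ifs <;> rfl
  rw [hite] at h
  have h' := congrArg (fun z => 2 * z) h
  refine h'.trans ?_
  change _ = 2 * (R.1 p * (if i = k then (1 : smoothFun (slit U)) else 0).1 p)
    - (fiberDer hU k R).1 p * p.1.2 i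
  ring

end Slit

/-- for a spray of isotropic curvature in dimension `n ≥ 3`,
`(1/2) R_{·l|m} y^m − R_{|l} = 0`. -/
theorem isotropic_curvature_identity_dim_ge_three
    {n : ℕ} (hn : 3 ≤ n) (U : Set (Vec n)) (hU : IsOpen U)
    (G : Fin n → Vec n → Vec n → ℝ) (hG : IsSpray U G)
    (hiso : IsIsotropicCurv U G) :
    ∀ x ∈ U, ∀ y : Vec n, y ≠ 0 → ∀ l,
      (1 / 2) *
          (∑ m, y m * hd G (fun x' y' => pdy (Rsc G) l x' y') m x y
            - ∑ s, Nc G s l x y * pdy (Rsc G) s x y)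
        - hd G (Rsc G) l x y = 0 := by
  obtain ⟨g, hrep⟩ : ∃ g : Fin n → smoothFun (slit U), ∀ i, Represents (G i) (g i) :=
    ⟨fun i => smoothRestrict _ (hG.1 i), fun _ _ => rfl⟩
  have heuler := euler_of_homogeneous hU hrep hG.2
  have hcurv := Represents.riem2 hU hrep heuler
  obtain ⟨R, hRrep, htr⟩ := Represents.rsc hU hrep heuler (by omega)
  intro x hx y hy l
  have h := isotropic_identity hn (baseDer_comm hU) (baseDer_fiberDer_comm hU) (fiberDer_comm hU)
    (baseDer_fiberCoord hU) (fiberDer_fiberCoord hU) heuler htr (hRrep.isotropic hU hcurv hiso) l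
  let p : slit U := ⟨(x, y), hx, hy⟩
  have hhd : ∀ m, hd G (fun x' y' => pdy (Rsc G) l x' y') m x y
      = (horDer (baseDer hU) (fiberDer hU) g m (fiberDer hU l R)).1 p :=
    fun m => (hRrep.pdy hU l).hd hU hrep m p
  have hhR : hd G (Rsc G) l x y = (horDer (baseDer hU) (fiberDer hU) g l R).1 p :=
    hRrep.hd hU hrep l p
  have hN : ∀ s, Nc G s l x y = (fiberDer hU l (g s)).1 p := fun s => (hrep s).pdy hU l p
  have hY : ∀ s, pdy (Rsc G) s x y = (fiberDer hU s R).1 p := fun s => hRrep.pdy hU s p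
  simp only [hhd, hhR, hN, hY]
  have hp := coe_smoothFun_sum_mul_sub h p
  have hy' : ∀ m, (fiberCoord U m).1 p = y m := fun m => rfl
  simp only [hy'] at hp
  linear_combination (1 / 2) * hp
end
end

section
/- Let G₁ and G₂ be projectively equivalent sprays on an open set U ⊆ ℝⁿ (n ≥ 2), i.e., G₁ⁱ = G₂ⁱ + P yⁱ for some smooth function P(x,y) positively homogeneous of degree 1 in y. Then for any volume form dV = σ(x) dx¹⋯dxⁿ on U, the sprays Ĝ₁ associated with (G₁, dV) and Ĝ₂ associated with (G₂, dV) coincide: Ĝ₁ⁱ = Ĝ₂ⁱ for all i. -/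
open scoped BigOperators

noncomputable section

variable {n : ℕ}

/-- Euler's identity along the ray: a function that is differentiable at `y` and positively
homogeneous of degree one satisfies `Df(y) y = f(y)`. -/
theorem fderiv_apply_self_of_posHomogeneous {E : Type*} [NormedAddCommGroup E] [NormedSpace ℝ E]
    {f : E → ℝ} {y : E} (hf : DifferentiableAt ℝ f y)
    (hom : ∀ c : ℝ, 0 < c → f (c • y) = c * f y) : fderiv ℝ f y y = f y := by
  have hray : HasDerivAt (fun c : ℝ => c • y) y 1 := by
    simpa using (hasDerivAt_id (1 : ℝ)).smul_const y
  have hf' : HasFDerivAt f (fderiv ℝ f y) ((1 : ℝ) • y) := by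
    simpa using hf.hasFDerivAt
  have h₁ : HasDerivAt (fun c : ℝ => f (c • y)) (fderiv ℝ f y y) 1 :=
    hf'.comp_hasDerivAt 1 hray
  have h₂ : HasDerivAt (fun c : ℝ => c * f y) (f y) 1 := by
    simpa using (hasDerivAt_id (1 : ℝ)).mul_const (f y)
  refine h₁.unique (h₂.congr_of_eventuallyEq ?_)
  filter_upwards [lt_mem_nhds (zero_lt_one (α := ℝ))] with c hc using hom c hc

/-- The directional derivative along `y` in terms of the fiber partial derivatives. -/
theorem sum_mul_pdy {n : ℕ} (f : Vec n → Vec n → ℝ) (x y : Vec n) :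
    ∑ m, y m * pdy f m x y = fderiv ℝ (fun y' => f x y') y y := by
  have hy : y = ∑ m, y m • (Pi.single m 1 : Vec n) := by
    ext j
    simp [Pi.single_apply]
  calc ∑ m, y m * pdy f m x y
      = fderiv ℝ (fun y' => f x y') y (∑ m, y m • (Pi.single m 1 : Vec n)) := by
        simp only [pdy, map_sum, map_smul, smul_eq_mul]
    _ = fderiv ℝ (fun y' => f x y') y y := by rw [← hy]

/-- A function smooth on `U × (ℝⁿ ∖ {0})` is differentiable in the fiber variable. -/
theorem differentiableAt_fiber {n : ℕ} {U : Set (Vec n)} (hU : IsOpen U)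
    {f : Vec n → Vec n → ℝ}
    (hf : ContDiffOn ℝ (⊤ : ℕ∞) (fun p : Vec n × Vec n => f p.1 p.2)
      (U ×ˢ {y : Vec n | y ≠ 0}))
    {x y : Vec n} (hx : x ∈ U) (hy : y ≠ 0) : DifferentiableAt ℝ (fun y' => f x y') y := by
  have hopen : IsOpen (U ×ˢ {y : Vec n | y ≠ 0}) := hU.prod isOpen_ne
  have h : DifferentiableAt ℝ (fun p : Vec n × Vec n => f p.1 p.2) (x, y) :=
    (hf.contDiffAt (hopen.mem_nhds (Set.mk_mem_prod hx hy))).differentiableAt (by simp)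
  exact h.comp y (g := fun p : Vec n × Vec n => f p.1 p.2) (f := fun y' => (x, y'))
    ((differentiableAt_const x).prodMk differentiableAt_id)

/-- Adding `P yⁱ` to the spray coefficients, with `P` positively homogeneous of degree one,
changes `Π` by `(n + 1) P`. -/
theorem PiG_of_projectively_equivalent {n : ℕ} {G₁ G₂ : Fin n → Vec n → Vec n → ℝ}
    {P : Vec n → Vec n → ℝ} {x y : Vec n} (hy : y ≠ 0)
    (hG₂ : ∀ i, DifferentiableAt ℝ (fun y' => G₂ i x y') y)
    (hP : DifferentiableAt ℝ (fun y' => P x y') y)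
    (hPhom : ∀ c : ℝ, 0 < c → P x (c • y) = c * P x y)
    (hproj : ∀ i, ∀ y : Vec n, y ≠ 0 → G₁ i x y = G₂ i x y + P x y * y i) :
    PiG G₁ x y = PiG G₂ x y + ((n : ℝ) + 1) * P x y := by
  have hN : ∀ m, Nc G₁ m m x y = Nc G₂ m m x y + (P x y + y m * pdy P m x y) := by
    intro m
    have hcoord : HasFDerivAt (fun y' : Vec n => y' m)
        (ContinuousLinearMap.proj m : Vec n →L[ℝ] ℝ) y :=
      (ContinuousLinearMap.proj m : Vec n →L[ℝ] ℝ).hasFDerivAt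
    have hsum := (hG₂ m).hasFDerivAt.add (hP.hasFDerivAt.mul hcoord)
    have heq : (fun y' => G₁ m x y') =ᶠ[nhds y]
        ((fun y' => G₂ m x y') + (fun y' => P x y') * fun y' : Vec n => y' m) := by
      filter_upwards [isOpen_ne.mem_nhds hy] with y' hy' using hproj m y' hy'
    have hfd := (hsum.congr_of_eventuallyEq heq).fderiv
    simp only [Nc, pdy]
    rw [hfd]
    simp
  have hEuler : ∑ m, y m * pdy P m x y = P x y := by
    rw [sum_mul_pdy]
    exact fderiv_apply_self_of_posHomogeneous hP hPhom
  simp only [PiG, hN, Finset.sum_add_distrib, hEuler, Finset.sum_const, Finset.card_univ,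
    Fintype.card_fin, nsmul_eq_mul]
  ring

/-- the associated sprays of two projectively equivalent sprays coincide. -/
theorem associated_sprays_of_projectively_equivalent_coincide
    {n : ℕ} (hn : 2 ≤ n) (U : Set (Vec n)) (hU : IsOpen U)
    (G₁ G₂ : Fin n → Vec n → Vec n → ℝ) (hG₁ : IsSpray U G₁) (hG₂ : IsSpray U G₂)
    (P : Vec n → Vec n → ℝ)
    (hPsm : ContDiffOn ℝ (⊤ : ℕ∞) (fun p : Vec n × Vec n => P p.1 p.2)
      (U ×ˢ {y : Vec n | y ≠ 0}))
    (hPhom : ∀ (x y : Vec n) (lam : ℝ), 0 < lam → P x (lam • y) = lam * P x y)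
    (hproj : ∀ i, ∀ x ∈ U, ∀ y : Vec n, y ≠ 0 → G₁ i x y = G₂ i x y + P x y * y i)
    (σ : Vec n → ℝ) (hσ : IsVolumeForm U σ) :
    ∀ x ∈ U, ∀ y : Vec n, y ≠ 0 → ∀ i, Ghat G₁ σ i x y = Ghat G₂ σ i x y := by
  intro x hx y hy i
  have hPi := PiG_of_projectively_equivalent hy
    (fun j => differentiableAt_fiber hU (hG₂.1 j) hx hy)
    (differentiableAt_fiber hU hPsm hx hy) (hPhom x y) (fun j => hproj j x hx)
  have hn' : (n : ℝ) + 1 ≠ 0 := by positivity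
  simp only [Ghat, Scurv, hPi, hproj i x hx y hy]
  field_simp
  ring
end
end
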